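/- arXiv:2410.21150 — 2 statements merged into one kernel-verified Lean document; each statement's English description precedes it below -/
import Mathlib

section
/- Let p > 0 and K > 0, and let f : ℝ → ℝ be continuously differentiable with f(0) = 0 and |f'(y)| ≤ K·(1 + |y|^p) for all y ∈ ℝ. Then there exists a constant C > 0, depending only on p and K, such that for all continuously differentiable compactly supported functions v, w : ℝ² → ℝ, ‖f∘v − f∘w‖_{L²(ℝ²)} ≤ C · (1 + ‖v‖_{H¹}^p + ‖w‖_{H¹}^p) · ‖v − w‖_{H¹}. -/
open MeasureTheory

/-- The `L²(ℝ²)`-norm of a real-valued function. -/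
noncomputable def L2norm (u : EuclideanSpace ℝ (Fin 2) → ℝ) : ℝ :=
  (eLpNorm u 2 volume).toReal

/-- The `H¹(ℝ²)`-norm `‖u‖_{L²} + ‖∇u‖_{L²}` of a real-valued function. -/
noncomputable def H1norm (u : EuclideanSpace ℝ (Fin 2) → ℝ) : ℝ :=
  (eLpNorm u 2 volume).toReal + (eLpNorm (fun x => ‖fderiv ℝ u x‖) 2 volume).toReal

local notation "ℝ²" => EuclideanSpace ℝ (Fin 2)

theorem H1norm_nonneg (u : ℝ² → ℝ) : 0 ≤ H1norm u :=
  add_nonneg ENNReal.toReal_nonneg ENNReal.toReal_nonneg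

theorem L2norm_le_H1norm (u : ℝ² → ℝ) : L2norm u ≤ H1norm u :=
  le_add_of_nonneg_right ENNReal.toReal_nonneg

theorem L2norm_mono {g h : ℝ² → ℝ} (hh : MemLp h 2 volume) (hgh : ∀ x, |g x| ≤ h x) :
    L2norm g ≤ L2norm h :=
  ENNReal.toReal_mono hh.eLpNorm_ne_top (eLpNorm_mono_real hgh)

theorem L2norm_add_le {g h : ℝ² → ℝ} (hg : MemLp g 2 volume) (hh : MemLp h 2 volume) :
    L2norm (fun x => g x + h x) ≤ L2norm g + L2norm h := by
  unfold L2norm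
  rw [← ENNReal.toReal_add hg.eLpNorm_ne_top hh.eLpNorm_ne_top]
  exact ENNReal.toReal_mono (ENNReal.add_ne_top.2 ⟨hg.eLpNorm_ne_top, hh.eLpNorm_ne_top⟩)
    (eLpNorm_add_le hg.1 hh.1 (by norm_num))

theorem L2norm_const_mul_abs {c : ℝ} (hc : 0 ≤ c) (g : ℝ² → ℝ) :
    L2norm (fun x => c * |g x|) = c * L2norm g := by
  unfold L2norm
  have h := eLpNorm_const_smul c (fun x => ‖g x‖) 2 (volume : Measure ℝ²)
  rw [eLpNorm_norm] at h
  have h' : (fun x => c * |g x|) = c • fun x => ‖g x‖ := rfl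
  rw [h', h, ENNReal.toReal_mul, toReal_enorm, Real.norm_of_nonneg hc]

/-- Cauchy–Schwarz for the square of a product. -/
theorem L2norm_mul_sq_le {g h : ℝ² → ℝ} (hg : MemLp (fun x => g x ^ 2) 2 volume)
    (hh : MemLp (fun x => h x ^ 2) 2 volume) :
    L2norm (fun x => g x * h x) ^ 2 ≤ L2norm (fun x => g x ^ 2) * L2norm (fun x => h x ^ 2) := by
  have key : eLpNorm (fun x => g x * h x) 2 (volume : Measure ℝ²) ^ 2 ≤
      eLpNorm (fun x => g x ^ 2) 2 volume * eLpNorm (fun x => h x ^ 2) 2 volume := by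
    have h1 := eLpNorm_smul_le_mul_eLpNorm (p := 2) (q := 2) (r := 1) hh.1 hg.1
    have h2 := eLpNorm_norm_rpow (p := 1) (q := 2) (μ := volume) (fun x => g x * h x) (by norm_num)
    simp only [one_mul, ENNReal.ofReal_ofNat, ENNReal.rpow_ofNat, Real.rpow_ofNat] at h2
    rw [← h2]
    convert h1 using 2
    ext x
    simp [mul_pow]
  unfold L2norm
  rw [← ENNReal.toReal_pow, ← ENNReal.toReal_mul]
  exact ENNReal.toReal_mono (ENNReal.mul_ne_top hg.eLpNorm_ne_top hh.eLpNorm_ne_top) key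

theorem memLp_two_pow {u : ℝ² → ℝ} (hu : Continuous u) (hus : HasCompactSupport u) {n : ℕ}
    (hn : n ≠ 0) : MemLp (fun x => u x ^ n) 2 volume :=
  (hu.pow n).memLp_of_hasCompactSupport (hus.comp_left (g := fun y => y ^ n) (zero_pow hn))

/-- The two-dimensional Sobolev embedding of `H¹` into `L^{2(k+1)}`. -/
theorem exists_L2norm_pow_le (k : ℕ) : ∃ C : ℝ, 0 ≤ C ∧ ∀ u : ℝ² → ℝ, ContDiff ℝ 1 u →
    HasCompactSupport u → L2norm (fun x => u x ^ (k + 1)) ≤ C * H1norm u ^ (k + 1) := by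
  induction k with
  | zero => exact ⟨1, zero_le_one, fun u _ _ => by simpa using L2norm_le_H1norm u⟩
  | succ k ih =>
    obtain ⟨C, hC, ih⟩ := ih
    set S := eLpNormLESNormFDerivOneConst (volume : Measure ℝ²) (2 : NNReal)
    refine ⟨S * ((k + 2) * C), by positivity, fun u hu hsupp => ?_⟩
    have hpow (n : ℕ) : MemLp (fun x => u x ^ (n + 1)) 2 (volume : Measure ℝ²) :=
      memLp_two_pow hu.continuous hsupp n.succ_ne_zero
    have hgrad : MemLp (fderiv ℝ u) 2 (volume : Measure ℝ²) :=
      (hu.continuous_fderiv one_ne_zero).memLp_of_hasCompactSupport (hsupp.fderiv ℝ)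
    have hfderiv : fderiv ℝ (fun x => u x ^ (k + 2)) =
        (k + 2 : ℝ) • ((fun x => u x ^ (k + 1)) • fderiv ℝ u) := by
      ext1 x
      rw [((hu.differentiable one_ne_zero x).hasFDerivAt.pow (k + 2)).fderiv]
      simp [smul_smul, mul_comm]
    have hsob := eLpNorm_le_eLpNorm_fderiv_one (volume : Measure ℝ²) (hu.pow (k + 2))
      (hsupp.comp_left (g := fun y => y ^ (k + 2)) (by simp)) (p := 2)
      (by
        rw [finrank_euclideanSpace_fin]
        exact ⟨by norm_num, by norm_num, by norm_num⟩)
    have hsmul := eLpNorm_const_smul (k + 2 : ℝ) ((fun x => u x ^ (k + 1)) • fderiv ℝ u) 1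
      (volume : Measure ℝ²)
    rw [hfderiv, hsmul, ENNReal.coe_ofNat] at hsob
    have hholder := eLpNorm_smul_le_mul_eLpNorm (p := 2) (q := 2) (r := 1) hgrad.1 (hpow k).1
    have hreal : L2norm (fun x => u x ^ (k + 2)) ≤ S * ((k + 2) *
        (L2norm (fun x => u x ^ (k + 1)) * (eLpNorm (fderiv ℝ u) 2 volume).toReal)) := by
      have := ENNReal.toReal_mono (ENNReal.mul_ne_top ENNReal.coe_ne_top <|
        ENNReal.mul_ne_top enorm_ne_top <|
        ENNReal.mul_ne_top (hpow k).eLpNorm_ne_top hgrad.eLpNorm_ne_top)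
        (hsob.trans (by gcongr))
      rw [ENNReal.toReal_mul, ENNReal.toReal_mul, ENNReal.toReal_mul, toReal_enorm,
        Real.norm_of_nonneg (by positivity)] at this
      exact this
    have hgradle : (eLpNorm (fderiv ℝ u) 2 volume).toReal ≤ H1norm u := by
      unfold H1norm
      rw [eLpNorm_norm]
      exact le_add_of_nonneg_left ENNReal.toReal_nonneg
    have hH := H1norm_nonneg u
    calc L2norm (fun x => u x ^ (k + 2))
        ≤ S * ((k + 2) * (L2norm (fun x => u x ^ (k + 1)) *
          (eLpNorm (fderiv ℝ u) 2 volume).toReal)) := hreal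
      _ ≤ S * ((k + 2) * ((C * H1norm u ^ (k + 1)) * H1norm u)) := by
        gcongr
        exact ih u hu hsupp
      _ = S * ((k + 2) * C) * H1norm u ^ (k + 1 + 1) := by ring

theorem exists_L2norm_pow_mul_le (m : ℕ) (hm : 0 < m) :
    ∃ D : ℝ, 0 ≤ D ∧ ∀ u z : ℝ² → ℝ, ContDiff ℝ 1 u → HasCompactSupport u →
      ContDiff ℝ 1 z → HasCompactSupport z →
      L2norm (fun x => u x ^ m * z x) ≤ D * H1norm u ^ m * H1norm z := by
  obtain ⟨A, hA, hA'⟩ := exists_L2norm_pow_le (2 * m - 1)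
  obtain ⟨B, hB, hB'⟩ := exists_L2norm_pow_le 1
  refine ⟨√(A * B), Real.sqrt_nonneg _, fun u z hu hus hz hzs => ?_⟩
  have hU := H1norm_nonneg u
  have hZ := H1norm_nonneg z
  have h1 := hA' u hu hus
  have h2 := hB' z hz hzs
  have hm2 : 2 * m - 1 + 1 = m * 2 := by omega
  simp only [hm2, pow_mul] at h1
  have hum : HasCompactSupport fun x => u x ^ m :=
    hus.comp_left (g := fun y => y ^ m) (zero_pow hm.ne')
  have hsq := L2norm_mul_sq_le (memLp_two_pow (hu.continuous.pow m) hum two_ne_zero)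
    (memLp_two_pow hz.continuous hzs two_ne_zero)
  refine (pow_le_pow_iff_left₀ ENNReal.toReal_nonneg (by positivity) two_ne_zero).1 ?_
  calc L2norm (fun x => u x ^ m * z x) ^ 2
      ≤ L2norm (fun x => (u x ^ m) ^ 2) * L2norm (fun x => z x ^ 2) := hsq
    _ ≤ (A * (H1norm u ^ m) ^ 2) * (B * H1norm z ^ 2) :=
      mul_le_mul h1 h2 ENNReal.toReal_nonneg (by positivity)
    _ = (√(A * B) * H1norm u ^ m * H1norm z) ^ 2 := by
      rw [mul_pow, mul_pow, Real.sq_sqrt (by positivity)]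
      ring

/-- Scale-invariant domination of a real power by an integer power. -/
theorem exists_abs_rpow_le {p : ℝ} (hp : 0 < p) {m : ℕ} (hpm : p ≤ m) {u : ℝ² → ℝ}
    (hu : ContDiff ℝ 1 u) (hus : HasCompactSupport u) :
    ∃ c : ℝ, 0 ≤ c ∧ c * H1norm u ^ m ≤ H1norm u ^ p ∧
      ∀ x, |u x| ^ p ≤ H1norm u ^ p + c * |u x| ^ m := by
  rcases (H1norm_nonneg u).eq_or_lt with h0 | hpos
  · have hL : eLpNorm u 2 volume = 0 := by
      have hmem : MemLp u 2 volume := hu.continuous.memLp_of_hasCompactSupport hus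
      have : (eLpNorm u 2 volume).toReal = 0 :=
        le_antisymm ((L2norm_le_H1norm u).trans h0.ge) ENNReal.toReal_nonneg
      exact ((ENNReal.toReal_eq_zero_iff _).1 this).resolve_right hmem.eLpNorm_ne_top
    rw [eLpNorm_eq_zero_iff hu.continuous.aestronglyMeasurable two_ne_zero,
      hu.continuous.ae_eq_iff_eq _ continuous_zero] at hL
    exact ⟨0, le_rfl, by simp [← h0, Real.zero_rpow hp.ne'],
      fun x => by rw [← h0]; simp [hL, Real.zero_rpow hp.ne']⟩
  · refine ⟨H1norm u ^ p / H1norm u ^ m, by positivity, by field_simp; rfl, fun x => ?_⟩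
    have hle : (|u x| / H1norm u) ^ p ≤ 1 + (|u x| / H1norm u) ^ m := by
      have hr : 0 ≤ |u x| / H1norm u := by positivity
      rcases le_total (|u x| / H1norm u) 1 with h | h
      · exact (Real.rpow_le_one hr h hp.le).trans (le_add_of_nonneg_right (by positivity))
      · refine (Real.rpow_le_rpow_of_exponent_le h hpm).trans ?_
        rw [Real.rpow_natCast]
        linarith
    rw [Real.div_rpow (abs_nonneg _) hpos.le, div_pow,
      div_le_iff₀ (by positivity)] at hle
    calc _ ≤ _ := hle
      _ = _ := by ring

theorem abs_sub_le_of_abs_deriv_le {p K : ℝ} (hp : 0 < p) (hK : 0 < K) {f : ℝ → ℝ}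
    (hf : Differentiable ℝ f) (hf' : ∀ y, |deriv f y| ≤ K * (1 + |y| ^ p)) (a b : ℝ) :
    |f a - f b| ≤ K * (1 + |a| ^ p + |b| ^ p) * |a - b| := by
  refine Convex.norm_image_sub_le_of_norm_deriv_le (s := Set.uIcc b a) (fun y _ => hf y)
    (fun y hy => (hf' y).trans ?_) (convex_uIcc b a) Set.left_mem_uIcc Set.right_mem_uIcc
  have ha : 0 ≤ |a| ^ p := by positivity
  have hb : 0 ≤ |b| ^ p := by positivity
  have hy' : |y| ≤ max |b| |a| := by
    rcases Set.mem_uIcc.1 hy with h | h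
    · exact abs_le_max_abs_abs h.1 h.2
    · rw [max_comm]
      exact abs_le_max_abs_abs h.1 h.2
  have : |y| ^ p ≤ |a| ^ p + |b| ^ p := by
    refine (Real.rpow_le_rpow (abs_nonneg _) hy' hp.le).trans ?_
    rcases max_choice |b| |a| with h | h <;> rw [h] <;> linarith
  rw [add_assoc]
  gcongr

/-- Lemma 3 of the paper (the Larsson lemma), second estimate, in dimension `d = 2`:
if `f(0) = 0` and `|f'| ≤ K(1 + |·|^p)`, then `‖f∘v − f∘w‖_{L²} ≲ ‖v − w‖_{H¹}` with a
constant depending only on `p` and `K` (polynomially on the `H¹` norms of `v` and `w`). -/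
theorem larsson_L2_estimate (p K : ℝ) (hp : 0 < p) (hK : 0 < K) :
    ∃ C : ℝ, 0 < C ∧ ∀ f : ℝ → ℝ, ContDiff ℝ 1 f → f 0 = 0 →
      (∀ y : ℝ, |deriv f y| ≤ K * (1 + |y| ^ p)) →
      ∀ v w : EuclideanSpace ℝ (Fin 2) → ℝ,
        ContDiff ℝ 1 v → HasCompactSupport v →
        ContDiff ℝ 1 w → HasCompactSupport w →
        L2norm (fun x => f (v x) - f (w x)) ≤
          C * (1 + H1norm v ^ p + H1norm w ^ p) * H1norm (fun x => v x - w x) := by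
  set m := ⌈p⌉₊
  obtain ⟨D, hD, hprod⟩ := exists_L2norm_pow_mul_le m (Nat.ceil_pos.2 hp)
  refine ⟨K * (1 + D), by positivity, fun f hf _ hf' v w hv hvs hw hws => ?_⟩
  obtain ⟨a, ha, hav, hav'⟩ := exists_abs_rpow_le hp (Nat.le_ceil p) hv hvs
  obtain ⟨b, hb, hbw, hbw'⟩ := exists_abs_rpow_le hp (Nat.le_ceil p) hw hws
  set z : ℝ² → ℝ := fun x => v x - w x
  have hz : ContDiff ℝ 1 z := hv.sub hw
  have hzs : HasCompactSupport z := hvs.sub hws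
  have hV := H1norm_nonneg v
  have hW := H1norm_nonneg w
  have hZ := H1norm_nonneg z
  set M := 1 + H1norm v ^ p + H1norm w ^ p with hM
  have hM0 : 0 ≤ M := by positivity
  have hmem (c : ℝ) {g : ℝ² → ℝ} (hg : Continuous g) (hgs : HasCompactSupport g) :
      MemLp (fun x => c * |g x|) 2 (volume : Measure ℝ²) :=
    (hg.abs.const_mul c).memLp_of_hasCompactSupport
      (hgs.comp_left (g := fun y => c * |y|) (by simp))
  have hmz := hmem (K * M) hz.continuous hzs
  have hmv := hmem (K * a) (g := fun x => v x ^ m * z x)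
    ((hv.continuous.pow m).mul hz.continuous) hzs.mul_left
  have hmw := hmem (K * b) (g := fun x => w x ^ m * z x)
    ((hw.continuous.pow m).mul hz.continuous) hzs.mul_left
  have hpt (x : ℝ²) : |f (v x) - f (w x)| ≤
      K * M * |z x| + K * a * |v x ^ m * z x| + K * b * |w x ^ m * z x| := by
    calc |f (v x) - f (w x)| ≤ K * (1 + |v x| ^ p + |w x| ^ p) * |z x| :=
          abs_sub_le_of_abs_deriv_le hp hK (hf.differentiable one_ne_zero) hf' _ _
      _ ≤ K * (1 + (H1norm v ^ p + a * |v x| ^ m) + (H1norm w ^ p + b * |w x| ^ m)) * |z x| := by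
        gcongr
        · exact hav' x
        · exact hbw' x
      _ = _ := by
        simp only [abs_mul, abs_pow, hM]
        ring
  calc L2norm (fun x => f (v x) - f (w x))
      ≤ L2norm (fun x => K * M * |z x| + K * a * |v x ^ m * z x| + K * b * |w x ^ m * z x|) :=
        L2norm_mono ((hmz.add hmv).add hmw) hpt
    _ ≤ K * M * L2norm z + K * a * L2norm (fun x => v x ^ m * z x) +
        K * b * L2norm (fun x => w x ^ m * z x) := by
      rw [← L2norm_const_mul_abs (by positivity), ← L2norm_const_mul_abs (by positivity),
        ← L2norm_const_mul_abs (by positivity)]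
      exact (L2norm_add_le (hmz.add hmv) hmw).trans (add_le_add_left (L2norm_add_le hmz hmv) _)
    _ ≤ K * M * H1norm z + K * a * (D * H1norm v ^ m * H1norm z) +
        K * b * (D * H1norm w ^ m * H1norm z) := by
      gcongr
      · exact L2norm_le_H1norm z
      · exact hprod v z hv hvs hz hzs
      · exact hprod w z hw hws hz hzs
    _ = K * (M + D * (a * H1norm v ^ m + b * H1norm w ^ m)) * H1norm z := by ring
    _ ≤ K * (M + D * M) * H1norm z := by
      gcongr
      linarith
    _ = K * (1 + D) * M * H1norm z := by ring
end

section
/- For every B ≥ 0 and T > 0 there exists a constant C > 0 such that the following holds: for every Δt > 0 and N ∈ ℕ with N·Δt ≤ T, for every a ≥ 0 and every sequence of nonnegative real numbers ε_0, ε_1, …, ε_N satisfying ε_n ≤ a + B·Δt·∑_{k=0}^{n−1} ((n − k)·Δt)^{−1/2}·ε_k for all 0 ≤ n ≤ N, one has ε_n ≤ C·a for all 0 ≤ n ≤ N. -/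
/-- Each term of a Riemann sum of `s ^ (-1/2) * exp (-μ ^ 2 * s)` is dominated by an increment of
`s ↦ -(4 / μ) / (1 + μ * √s)`. -/
lemma mul_rpow_neg_half_mul_exp_le {h μ : ℝ} (hh : 0 < h) (hμ : 0 < μ) (j : ℕ) :
    h * ((((j + 1 : ℕ) : ℝ) * h) ^ (-(1 / 2) : ℝ) * Real.exp (-(μ ^ 2 * (((j + 1 : ℕ) : ℝ) * h)))) ≤
      4 / μ * ((1 + μ * √((j : ℝ) * h))⁻¹ - (1 + μ * √(((j + 1 : ℕ) : ℝ) * h))⁻¹) := by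
  have hs : 0 < ((j + 1 : ℕ) : ℝ) * h := by positivity
  have hr : 0 ≤ (j : ℝ) * h := by positivity
  have hdiff : h = ((j + 1 : ℕ) : ℝ) * h - (j : ℝ) * h := by push_cast; ring
  rw [Real.rpow_neg hs.le, ← Real.sqrt_eq_rpow]
  generalize ((j + 1 : ℕ) : ℝ) * h = s at *
  generalize (j : ℝ) * h = r at *
  obtain ⟨x, hx, rfl⟩ : ∃ x : ℝ, 0 < x ∧ s = x ^ 2 :=
    ⟨√s, Real.sqrt_pos.2 hs, (Real.sq_sqrt hs.le).symm⟩
  obtain ⟨y, hy, rfl⟩ : ∃ y : ℝ, 0 ≤ y ∧ r = y ^ 2 :=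
    ⟨√r, Real.sqrt_nonneg r, (Real.sq_sqrt hr).symm⟩
  rw [Real.sqrt_sq hx.le, Real.sqrt_sq hy]
  have hyx : y < x := by nlinarith
  have hstep : h * x⁻¹ ≤ 2 * (x - y) := by
    rw [← div_eq_mul_inv, div_le_iff₀ hx]
    nlinarith
  have hexp : Real.exp (-(μ ^ 2 * x ^ 2)) ≤ 2 * ((1 + μ * y) * (1 + μ * x))⁻¹ := by
    have hμy : μ * y ≤ μ * x := by gcongr
    have hle : (1 + μ * y) * (1 + μ * x) ≤ 2 * Real.exp (μ ^ 2 * x ^ 2) := by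
      nlinarith [Real.add_one_le_exp (μ ^ 2 * x ^ 2), sq_nonneg (μ * x - 1), mul_pos hμ hx]
    rw [Real.exp_neg, ← div_eq_mul_inv, le_div_iff₀ (by positivity), ← div_eq_inv_mul,
      div_le_iff₀ (Real.exp_pos _)]
    exact hle
  calc h * (x⁻¹ * Real.exp (-(μ ^ 2 * x ^ 2)))
      = h * x⁻¹ * Real.exp (-(μ ^ 2 * x ^ 2)) := by ring
    _ ≤ 2 * (x - y) * (2 * ((1 + μ * y) * (1 + μ * x))⁻¹) := by gcongr
    _ = 4 / μ * ((1 + μ * y)⁻¹ - (1 + μ * x)⁻¹) := by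
      have h₁ : 1 + μ * y ≠ 0 := by positivity
      have h₂ : 1 + μ * x ≠ 0 := by positivity
      field_simp
      ring

/-- The Riemann sums of `s ^ (-1/2) * exp (-μ ^ 2 * s)` are bounded by `4 / μ`, uniformly in the
step size. -/
lemma sum_rpow_neg_half_mul_exp_le {h μ : ℝ} (hh : 0 < h) (hμ : 0 < μ) (n : ℕ) :
    h * ∑ k ∈ Finset.range n, (((n : ℝ) - (k : ℝ)) * h) ^ (-(1 / 2) : ℝ) *
      Real.exp (-(μ ^ 2 * (((n : ℝ) - (k : ℝ)) * h))) ≤ 4 / μ := by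
  have hreflect : ∑ k ∈ Finset.range n, (((n : ℝ) - (k : ℝ)) * h) ^ (-(1 / 2) : ℝ) *
        Real.exp (-(μ ^ 2 * (((n : ℝ) - (k : ℝ)) * h))) =
      ∑ j ∈ Finset.range n, (((j + 1 : ℕ) : ℝ) * h) ^ (-(1 / 2) : ℝ) *
        Real.exp (-(μ ^ 2 * (((j + 1 : ℕ) : ℝ) * h))) := by
    rw [← Finset.sum_range_reflect]
    refine Finset.sum_congr rfl fun k hk => ?_
    have hk' := Finset.mem_range.1 hk
    rw [← Nat.cast_sub (by omega), show n - (n - 1 - k) = k + 1 by omega]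
  rw [hreflect, Finset.mul_sum]
  refine (Finset.sum_le_sum fun j _ => mul_rpow_neg_half_mul_exp_le hh hμ j).trans ?_
  rw [← Finset.mul_sum, Finset.sum_range_sub' fun j : ℕ => (1 + μ * √((j : ℝ) * h))⁻¹]
  have hpos : 0 < (1 + μ * √((n : ℝ) * h))⁻¹ := by positivity
  refine mul_le_of_le_one_right (by positivity) ?_
  simp only [Nat.cast_zero, zero_mul, Real.sqrt_zero, mul_zero, add_zero, inv_one]
  linarith

/-- The discrete Gronwall inequality with weakly singular kernel of exponent `1/2`,
the concluding step in the proof of the fully discrete error estimate (Theorem 2 of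
the paper). -/
theorem discrete_gronwall_singular_kernel :
    ∀ B : ℝ, 0 ≤ B → ∀ T : ℝ, 0 < T → ∃ C : ℝ, 0 < C ∧
      ∀ Δt : ℝ, 0 < Δt → ∀ N : ℕ, (N : ℝ) * Δt ≤ T →
      ∀ a : ℝ, 0 ≤ a → ∀ ε : ℕ → ℝ,
        (∀ n ≤ N, 0 ≤ ε n) →
        (∀ n ≤ N, ε n ≤ a + B * Δt * ∑ k ∈ Finset.range n,
            (((n : ℝ) - (k : ℝ)) * Δt) ^ (-(1 / 2) : ℝ) * ε k) →
        ∀ n ≤ N, ε n ≤ C * a := by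
  intro B hB T _
  obtain ⟨μ, hμ, hBμ⟩ : ∃ μ : ℝ, 0 < μ ∧ B * (4 / μ) ≤ 1 / 2 := by
    refine ⟨8 * B + 1, by positivity, ?_⟩
    rw [mul_div_assoc', div_le_iff₀ (by positivity)]
    linarith
  refine ⟨2 * Real.exp (μ ^ 2 * T), by positivity, ?_⟩
  intro Δt hΔt N hN a ha ε _ hrec
  have key : ∀ n ≤ N, ε n ≤ 2 * Real.exp (μ ^ 2 * (n * Δt)) * a := by
    intro n
    induction n using Nat.strong_induction_on with
    | _ n ih =>
      intro hn
      set E := Real.exp (μ ^ 2 * (n * Δt)) with hE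
      have hE1 : 1 ≤ E := Real.one_le_exp (by positivity)
      have hsum : ∑ k ∈ Finset.range n, (((n : ℝ) - (k : ℝ)) * Δt) ^ (-(1 / 2) : ℝ) * ε k ≤
          2 * E * a * ∑ k ∈ Finset.range n, (((n : ℝ) - (k : ℝ)) * Δt) ^ (-(1 / 2) : ℝ) *
            Real.exp (-(μ ^ 2 * (((n : ℝ) - (k : ℝ)) * Δt))) := by
        rw [Finset.mul_sum]
        refine Finset.sum_le_sum fun k hk => ?_
        have hkn := Finset.mem_range.1 hk
        have hsub : (0 : ℝ) ≤ (n : ℝ) - k := sub_nonneg.2 (by exact_mod_cast hkn.le)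
        have hsplit : Real.exp (μ ^ 2 * (k * Δt)) =
            E * Real.exp (-(μ ^ 2 * (((n : ℝ) - (k : ℝ)) * Δt))) := by
          rw [hE, ← Real.exp_add]
          ring_nf
        have hk' := ih k hkn (by omega)
        rw [hsplit] at hk'
        refine (mul_le_mul_of_nonneg_left hk' (by positivity)).trans_eq ?_
        ring
      have hkernel := sum_rpow_neg_half_mul_exp_le hΔt hμ n
      have hεn := hrec n hn
      generalize ∑ k ∈ Finset.range n, (((n : ℝ) - (k : ℝ)) * Δt) ^ (-(1 / 2) : ℝ) *
        Real.exp (-(μ ^ 2 * (((n : ℝ) - (k : ℝ)) * Δt))) = S at hsum hkernel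
      calc ε n ≤ _ := hεn
        _ ≤ a + B * Δt * (2 * E * a * S) := by gcongr
        _ = a + 2 * E * a * (B * (Δt * S)) := by ring
        _ ≤ a + 2 * E * a * (B * (4 / μ)) := by gcongr
        _ ≤ a + 2 * E * a * (1 / 2) := by gcongr
        _ ≤ 2 * E * a := by nlinarith
  intro n hn
  refine (key n hn).trans ?_
  have hnT : (n : ℝ) * Δt ≤ T := le_trans (by gcongr) hN
  gcongr
end
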